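/- For every complex number d with Re(d) > 0, there holds ₃F₂(3/2, −1/2, d+1; 7/2, d; 1) = (15π/64)(1 − 1/(2d)). -/

import Mathlib

open scoped Nat

/-- Pochhammer symbol `(x)_k = x (x+1) ⋯ (x+k-1)` for a complex number `x`. -/
noncomputable def poch (x : ℂ) (k : ℕ) : ℂ := (ascPochhammer ℂ k).eval x

/-- The generalized hypergeometric series
`ₚF_q(a₁,…,aₚ; b₁,…,b_q; z) = ∑ₖ ((a₁)ₖ ⋯ (aₚ)ₖ)/((b₁)ₖ ⋯ (b_q)ₖ) · zᵏ/k!`. -/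
noncomputable def hyp (a b : List ℂ) (z : ℂ) : ℂ :=
  ∑' k : ℕ, ((a.map (poch · k)).prod / (b.map (poch · k)).prod) * z ^ k / (k ! : ℂ)

/-- The coefficients of the power series of `√(1 - x)`. -/
noncomputable def sqrtCoeff (k : ℕ) : ℝ := (ascPochhammer ℝ k).eval (-1 / 2) / (k ! : ℝ)

lemma sqrtCoeff_zero : sqrtCoeff 0 = 1 := by simp [sqrtCoeff]

lemma sqrtCoeff_succ (k : ℕ) :
    sqrtCoeff (k + 1) = sqrtCoeff k * ((k - 1 / 2) / (k + 1)) := by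
  have h1 : (k ! : ℝ) ≠ 0 := by exact_mod_cast k.factorial_ne_zero
  have h2 : (k + 1 : ℝ) ≠ 0 := by positivity
  rw [sqrtCoeff, sqrtCoeff, ascPochhammer_succ_eval, Nat.factorial_succ]
  push_cast
  field_simp
  ring

lemma abs_sqrtCoeff_le (k : ℕ) : |sqrtCoeff k| ≤ 1 / (k + 1) := by
  induction k with
  | zero => simp [sqrtCoeff_zero]
  | succ k ih =>
    have h : |((k : ℝ) - 1 / 2) / (k + 1)| ≤ (k + 1) / (k + 2) := by
      have hk : (0 : ℝ) ≤ k := k.cast_nonneg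
      rw [abs_div, abs_of_pos (by positivity : (0 : ℝ) < k + 1),
        div_le_div_iff₀ (by positivity) (by positivity)]
      rcases abs_cases ((k : ℝ) - 1 / 2) with ⟨h, -⟩ | ⟨h, -⟩ <;> rw [h] <;> nlinarith
    rw [sqrtCoeff_succ, abs_mul]
    calc _ ≤ 1 / ((k : ℝ) + 1) * ((k + 1) / (k + 2)) := by gcongr
      _ = _ := by
        push_cast
        field_simp
        ring

lemma sqrtCoeff_eq_choose (k : ℕ) : sqrtCoeff k = (-1) ^ k * Ring.choose (1 / 2 : ℝ) k := by
  rw [sqrtCoeff, Ring.choose_eq_smul, Polynomial.descPochhammer_smeval_eq_ascPochhammer,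
    Polynomial.ascPochhammer_smeval_cast, Polynomial.ascPochhammer_smeval_eq_eval,
    neg_div, ascPochhammer_eval_neg_eq_descPochhammer, descPochhammer_eval_eq_ascPochhammer,
    smul_eq_mul]
  ring

lemma hasSum_sqrtCoeff {x : ℝ} (hx : |x| < 1) :
    HasSum (fun k ↦ sqrtCoeff k * x ^ k) √(1 - x) := by
  have h := (Real.one_add_rpow_hasFPowerSeriesOnBall_zero (a := 1 / 2)).hasSum (y := -x)
    (by simpa [enorm_eq_nnnorm, ← NNReal.coe_lt_coe] using hx)
  simp only [binomialSeries_apply, List.ofFn_const, List.prod_replicate, smul_eq_mul,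
    ← Real.sqrt_eq_rpow, zero_add] at h
  rw [← sub_eq_add_neg] at h
  convert! h using 2 with k
  rw [sqrtCoeff_eq_choose, neg_pow x]
  ring

lemma pow_mul_one_sub_le {x : ℝ} (h0 : 0 ≤ x) (h1 : x ≤ 1) (n : ℕ) :
    x ^ n * (1 - x) ≤ 1 / (n + 1) := by
  have h : (n + 1 : ℝ) * x ^ n ≤ ∑ i ∈ Finset.range (n + 1), x ^ i := by
    have := Finset.card_nsmul_le_sum (Finset.range (n + 1)) (fun i ↦ x ^ i) (x ^ n)
      fun i hi ↦ pow_le_pow_of_le_one h0 h1 (Nat.lt_succ_iff.mp (Finset.mem_range.mp hi))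
    simpa using this
  have hg := mul_neg_geom_sum x (n + 1)
  rw [le_div_iff₀ (by positivity)]
  nlinarith [mul_le_mul_of_nonneg_right h (sub_nonneg.mpr h1), pow_nonneg h0 (n + 1)]

lemma summable_one_div_succ_sq : Summable fun k : ℕ ↦ 1 / ((k : ℝ) + 1) ^ 2 := by
  simpa using (summable_nat_add_iff 1).mpr (Real.summable_one_div_nat_pow.mpr one_lt_two)

lemma integral_sin_sq_mul_cos_pow_four :
    ∫ t in (0 : ℝ)..Real.pi / 2, Real.sin t ^ 2 * Real.cos t ^ 4 = Real.pi / 32 := by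
  have hderiv (t : ℝ) : HasDerivAt (fun t ↦ t / 16 + Real.sin t * Real.cos t / 16
      + Real.sin t * Real.cos t ^ 3 / 24 - Real.sin t * Real.cos t ^ 5 / 6)
      (Real.sin t ^ 2 * Real.cos t ^ 4) t := by
    have hs := Real.hasDerivAt_sin t
    have hc := Real.hasDerivAt_cos t
    convert! ((((hasDerivAt_id t).div_const 16).add ((hs.mul hc).div_const 16)).add
      ((hs.mul (hc.pow 3)).div_const 24)).sub ((hs.mul (hc.pow 5)).div_const 6) using 1
    have h : Real.sin t ^ 2 = 1 - Real.cos t ^ 2 := Real.sin_sq t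
    simp only [Pi.pow_apply]
    push_cast
    linear_combination (1 / 16 - Real.cos t ^ 2 * (-1) / 8 + Real.cos t ^ 4 / 6) * h
  rw [intervalIntegral.integral_eq_sub_of_hasDerivAt (fun t _ ↦ hderiv t)
    (Continuous.intervalIntegrable (by fun_prop) _ _)]
  simp
  ring

lemma integral_sin_pow_mul_cos_pow_three (k : ℕ) :
    ∫ t in (0 : ℝ)..Real.pi / 2, Real.sin t ^ (2 * k + 2) * Real.cos t ^ 3 =
      2 / ((2 * k + 3) * (2 * k + 5)) := by
  have h := integral_sin_pow_mul_cos_pow_odd (a := 0) (b := Real.pi / 2) (2 * k + 2) 1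
  norm_num at h
  rw [h]
  have h2 (u : ℝ) : u ^ (2 * k + 2) * (1 - u ^ 2) = u ^ (2 * k + 2) - u ^ (2 * k + 4) := by ring
  simp_rw [h2]
  rw [intervalIntegral.integral_sub (Continuous.intervalIntegrable (by fun_prop) _ _)
    (Continuous.intervalIntegrable (by fun_prop) _ _), integral_pow, integral_pow]
  push_cast
  simp only [one_pow, ne_eq, Nat.add_eq_zero_iff, one_ne_zero, and_false, not_false_eq_true,
    zero_pow, sub_zero]
  have h3 : (2 * k + 2 + 1 : ℝ) ≠ 0 := by positivity
  have h4 : (2 * k + 4 + 1 : ℝ) ≠ 0 := by positivity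
  have h5 : (2 * k + 3 : ℝ) ≠ 0 := by positivity
  have h6 : (2 * k + 5 : ℝ) ≠ 0 := by positivity
  field_simp
  ring

lemma hasSum_sqrtCoeff_div :
    HasSum (fun k : ℕ ↦ sqrtCoeff k / ((2 * k + 3) * (2 * k + 5))) (Real.pi / 64) := by
  have key : HasSum (fun k : ℕ ↦ ∫ t in (0 : ℝ)..Real.pi / 2,
      sqrtCoeff k * (Real.sin t ^ (2 * k + 2) * Real.cos t ^ 3))
      (∫ t in (0 : ℝ)..Real.pi / 2, Real.sin t ^ 2 * Real.cos t ^ 4) := by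
    refine intervalIntegral.hasSum_integral_of_dominated_convergence
      (fun k _ ↦ 1 / ((k : ℝ) + 1) ^ 2)
      (fun k ↦ Continuous.aestronglyMeasurable (by fun_prop)) (fun k ↦ ?_)
      (Filter.Eventually.of_forall fun _ _ ↦ summable_one_div_succ_sq)
      intervalIntegrable_const ?_
    · refine Filter.Eventually.of_forall fun t _ ↦ ?_
      have h1 := pow_mul_one_sub_le (sq_nonneg (Real.sin t)) (Real.sin_sq_le_one t) k
      have hc := Real.abs_cos_le_one t
      have h2 : |Real.sin t ^ (2 * k + 2) * Real.cos t ^ 3| ≤ 1 / ((k : ℝ) + 1) := by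
        calc |Real.sin t ^ (2 * k + 2) * Real.cos t ^ 3|
            = (Real.sin t ^ 2) ^ k * (1 - Real.sin t ^ 2) *
                (Real.sin t ^ 2 * |Real.cos t|) := by
              rw [← Real.cos_sq', abs_mul, abs_pow (Real.cos t), pow_succ |Real.cos t|, sq_abs,
                show Real.sin t ^ (2 * k + 2) = (Real.sin t ^ 2) ^ k * Real.sin t ^ 2 by ring,
                abs_of_nonneg (by positivity)]
              ring
          _ ≤ 1 / ((k : ℝ) + 1) * (1 * 1) := by
              have := Real.sin_sq_le_one t
              gcongr
          _ = _ := by ring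
      rw [Real.norm_eq_abs, abs_mul]
      calc _ ≤ 1 / ((k : ℝ) + 1) * (1 / ((k : ℝ) + 1)) := by
            gcongr
            exact abs_sqrtCoeff_le k
        _ = _ := by field_simp
    · refine Filter.Eventually.of_forall fun t ht ↦ ?_
      rw [Set.uIoc_of_le (by positivity)] at ht
      have hc0 : 0 ≤ Real.cos t :=
        Real.cos_nonneg_of_mem_Icc ⟨by linarith [ht.1, Real.pi_pos], ht.2⟩
      rcases hc0.eq_or_lt with h0 | h0
      · simp [← h0, hasSum_zero]
      · have hs : |Real.sin t ^ 2| < 1 := by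
          rw [abs_of_nonneg (sq_nonneg _), Real.sin_sq]
          nlinarith
        have h := (hasSum_sqrtCoeff hs).mul_right (Real.sin t ^ 2 * Real.cos t ^ 3)
        rw [← Real.cos_sq', Real.sqrt_sq hc0] at h
        convert! h using 1
        · ext k
          ring
        · ring
  simp_rw [intervalIntegral.integral_const_mul, integral_sin_pow_mul_cos_pow_three,
    integral_sin_sq_mul_cos_pow_four] at key
  convert! key.div_const 2 using 1
  · ext k
    ring
  · ring

lemma sum_range_sqrtCoeff (n : ℕ) :
    ∑ k ∈ Finset.range n, (2 * k + 1) * (sqrtCoeff k / ((2 * k + 3) * (2 * k + 5))) =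
      -(2 / 3) * (n * sqrtCoeff n / (2 * n + 3)) := by
  induction n with
  | zero => simp
  | succ n ih =>
    rw [Finset.sum_range_succ, ih, sqrtCoeff_succ]
    push_cast
    have h1 : (2 * n + 3 : ℝ) ≠ 0 := by positivity
    have h2 : (2 * n + 5 : ℝ) ≠ 0 := by positivity
    have h3 : (n + 1 : ℝ) ≠ 0 := by positivity
    rw [show (2 * (n + 1 : ℝ) + 3) = 2 * n + 5 by ring]
    field_simp
    ring

lemma hasSum_mul_sqrtCoeff_div :
    HasSum (fun k : ℕ ↦ (2 * k + 1) * (sqrtCoeff k / ((2 * k + 3) * (2 * k + 5)))) 0 := by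
  have hsum : Summable fun k : ℕ ↦
      (2 * k + 1) * (sqrtCoeff k / ((2 * k + 3) * (2 * k + 5))) := by
    refine summable_one_div_succ_sq.of_norm_bounded fun k ↦ ?_
    have hk : (0 : ℝ) ≤ k := k.cast_nonneg
    rw [Real.norm_eq_abs, abs_mul, abs_div, abs_of_pos (by positivity : (0 : ℝ) < 2 * k + 1),
      abs_of_pos (by positivity : (0 : ℝ) < (2 * k + 3) * (2 * k + 5))]
    calc _ ≤ (2 * k + 1) * (1 / ((k : ℝ) + 1) / ((2 * k + 3) * (2 * k + 5))) := by
          gcongr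
          exact abs_sqrtCoeff_le k
      _ ≤ _ := by
          rw [div_div, mul_one_div, div_le_div_iff₀ (by positivity) (by positivity)]
          nlinarith [mul_nonneg hk hk, mul_nonneg hk (mul_nonneg hk hk)]
  have hlim : Filter.Tendsto
      (fun n : ℕ ↦ -(2 / 3) * (n * sqrtCoeff n / (2 * n + 3) : ℝ)) Filter.atTop (nhds 0) := by
    refine squeeze_zero_norm (fun n ↦ ?_) tendsto_one_div_add_atTop_nhds_zero_nat
    have hn : (0 : ℝ) ≤ n := n.cast_nonneg
    have h : (n : ℝ) / (2 * n + 3) ≤ 1 := by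
      rw [div_le_one (by positivity)]
      linarith
    rw [Real.norm_eq_abs, mul_div_right_comm, abs_mul, abs_mul,
      abs_of_nonneg (by positivity : (0 : ℝ) ≤ n / (2 * n + 3)), abs_neg,
      abs_of_pos (by norm_num : (0 : ℝ) < 2 / 3)]
    calc _ ≤ (1 : ℝ) * (1 * (1 / ((n : ℝ) + 1))) := by
          gcongr
          · norm_num
          · exact abs_sqrtCoeff_le n
      _ = _ := by ring
  have h := hsum.hasSum.tendsto_sum_nat
  simp_rw [sum_range_sqrtCoeff] at h
  simpa [tendsto_nhds_unique h hlim] using hsum.hasSum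

lemma poch_succ (x : ℂ) (k : ℕ) : poch x (k + 1) = poch x k * (x + k) :=
  ascPochhammer_succ_eval k x

lemma poch_ne_zero {x : ℂ} (hx : 0 < x.re) (k : ℕ) : poch x k ≠ 0 := by
  induction k with
  | zero => simp [poch]
  | succ k ih =>
    rw [poch_succ]
    refine mul_ne_zero ih fun h ↦ ?_
    have := congrArg Complex.re h
    simp at this
    linarith [(k.cast_nonneg : (0 : ℝ) ≤ k)]

lemma poch_add_one_mul (x : ℂ) (k : ℕ) : poch (x + 1) k * x = poch x k * (x + k) := by
  induction k with
  | zero => simp [poch]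
  | succ k ih =>
    rw [poch_succ, poch_succ, mul_right_comm, ih]
    push_cast
    ring

lemma ofReal_sqrtCoeff (k : ℕ) : (sqrtCoeff k : ℂ) = poch (-1 / 2) k / (k ! : ℂ) := by
  have h : (((ascPochhammer ℝ k).eval (-1 / 2) : ℝ) : ℂ) = poch (-1 / 2) k := by
    induction k with
    | zero => simp [poch]
    | succ k ih =>
      rw [poch_succ, ascPochhammer_succ_eval, ← ih]
      push_cast
      ring
  rw [sqrtCoeff, ← h]
  push_cast
  rfl

theorem pi_formula_m1 (d : ℂ) (hd : 0 < d.re) :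
    hyp [3/2, -1/2, d + 1] [7/2, d] 1 =
      15 * (Real.pi : ℂ) / 64 * (1 - 1 / (2 * d)) := by
  have hd0 : d ≠ 0 := by
    rintro rfl
    simp at hd
  have hA := Complex.hasSum_ofReal.mpr hasSum_sqrtCoeff_div
  have hB := Complex.hasSum_ofReal.mpr hasSum_mul_sqrtCoeff_div
  have hsum := (hA.mul_left (15 * (1 - 1 / (2 * d)))).add (hB.mul_left (15 / (2 * d)))
  rw [hyp]
  refine (tsum_congr fun k ↦ ?_).trans (hsum.tsum_eq.trans ?_)
  · have h7 : poch (7 / 2) k ≠ 0 := poch_ne_zero (by norm_num) k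
    have hdk : poch d k ≠ 0 := poch_ne_zero hd k
    have hk : (k ! : ℂ) ≠ 0 := by exact_mod_cast k.factorial_ne_zero
    have h3 : (2 * k + 3 : ℂ) ≠ 0 := by exact_mod_cast (by omega : 2 * k + 3 ≠ 0)
    have h5 : (2 * k + 5 : ℂ) ≠ 0 := by exact_mod_cast (by omega : 2 * k + 5 ≠ 0)
    have e1 := poch_add_one_mul (3 / 2) k
    have e2 := poch_add_one_mul (5 / 2) k
    rw [show (3 / 2 + 1 : ℂ) = 5 / 2 by norm_num] at e1
    rw [show (5 / 2 + 1 : ℂ) = 7 / 2 by norm_num] at e2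
    have e3 : poch (3 / 2) k / poch (7 / 2) k = 15 / ((2 * k + 3) * (2 * k + 5)) := by
      rw [div_eq_div_iff h7 (mul_ne_zero h3 h5)]
      linear_combination -4 * (5 / 2 + k : ℂ) * e1 - 6 * e2
    have e4 : poch (d + 1) k / poch d k = 1 + k / d := by
      rw [div_eq_iff hdk]
      field_simp
      linear_combination poch_add_one_mul d k
    simp only [List.map_cons, List.map_nil, List.prod_cons, List.prod_nil, mul_one, one_pow]
    calc _ = poch (3 / 2) k / poch (7 / 2) k * (poch (d + 1) k / poch d k) *
          (poch (-1 / 2) k / (k ! : ℂ)) := by field_simp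
      _ = _ := by
        rw [e3, e4, ← ofReal_sqrtCoeff]
        push_cast
        field_simp
        ring
  · push_cast
    ring
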